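/- If a sequent Γ ⇒ Δ is provable in the non-well-founded sequent calculus Go_∞, then Γ ⇒ Δ is derivable in the ordinary sequent calculus Go_Seq. -/

import Mathlib

inductive Formula : Type
  | atom : ℕ → Formula
  | bot  : Formula
  | imp  : Formula → Formula → Formula
  | box  : Formula → Formula
deriving DecidableEq

def boxtimes (Γ : Multiset Formula) : Multiset Formula := Γ + Γ.map Formula.box

inductive GoSeq : Bool → Multiset Formula → Multiset Formula → Prop
  | ax (c) (Γ Δ : Multiset Formula) (A : Formula) : GoSeq c (A ::ₘ Γ) (A ::ₘ Δ)
  | axBot (c) (Γ Δ : Multiset Formula) : GoSeq c (Formula.bot ::ₘ Γ) Δ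
  | impL (c) (Γ Δ : Multiset Formula) (A B : Formula) :
      GoSeq c (B ::ₘ Γ) Δ → GoSeq c Γ (A ::ₘ Δ) → GoSeq c ((A.imp B) ::ₘ Γ) Δ
  | impR (c) (Γ Δ : Multiset Formula) (A B : Formula) :
      GoSeq c (A ::ₘ Γ) (B ::ₘ Δ) → GoSeq c Γ ((A.imp B) ::ₘ Δ)
  | boxGo (c) (Γ Δ Θ : Multiset Formula) (A : Formula) :
      GoSeq c ((Formula.box (A.imp (Formula.box A))) ::ₘ boxtimes Θ) {A} →
      GoSeq c (Γ + Θ.map Formula.box) ((Formula.box A) ::ₘ Δ)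
  | cut (Γ Δ : Multiset Formula) (A : Formula) :
      GoSeq true Γ (A ::ₘ Δ) → GoSeq true (A ::ₘ Γ) Δ → GoSeq true Γ Δ

inductive Frag : Bool → ℕ → Multiset Formula → Multiset Formula → Type
  | hole (c) (Γ Δ : Multiset Formula) : Frag c 0 Γ Δ
  | axP (c) (n) (Γ Δ : Multiset Formula) (p : ℕ) :
      Frag c (n+1) (Formula.atom p ::ₘ Γ) (Formula.atom p ::ₘ Δ)
  | axBot (c) (n) (Γ Δ : Multiset Formula) : Frag c (n+1) (Formula.bot ::ₘ Γ) Δ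
  | impL (c) (n) (Γ Δ : Multiset Formula) (A B : Formula) :
      Frag c (n+1) (B ::ₘ Γ) Δ → Frag c (n+1) Γ (A ::ₘ Δ) →
      Frag c (n+1) ((A.imp B) ::ₘ Γ) Δ
  | impR (c) (n) (Γ Δ : Multiset Formula) (A B : Formula) :
      Frag c (n+1) (A ::ₘ Γ) (B ::ₘ Δ) → Frag c (n+1) Γ ((A.imp B) ::ₘ Δ)
  | box (c) (n) (Γ Δ Θ : Multiset Formula) (l : List Formula) (h : l ≠ []) :
      Frag c (n+1) (boxtimes Θ) (boxtimes (↑l)) →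
      ((i : Fin l.length) → Frag c n (boxtimes Θ) {l.get i}) →
      Frag c (n+1) (Γ + Θ.map Formula.box) ((↑(l.map Formula.box) : Multiset Formula) + Δ)
  | cut (n) (Γ Δ : Multiset Formula) (A : Formula) :
      Frag true (n+1) Γ (A ::ₘ Δ) → Frag true (n+1) (A ::ₘ Γ) Δ → Frag true (n+1) Γ Δ

def Frag.trunc : ∀ {c : Bool} {n : ℕ} {Γ Δ : Multiset Formula}, Frag c (n+1) Γ Δ → Frag c n Γ Δ
  | c, 0, Γ, Δ, _ => .hole c Γ Δ
  | c, n+1, _, _, .axP _ _ Γ Δ p => .axP c n Γ Δ p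
  | c, n+1, _, _, .axBot _ _ Γ Δ => .axBot c n Γ Δ
  | c, n+1, _, _, .impL _ _ Γ Δ A B a b => .impL c n Γ Δ A B a.trunc b.trunc
  | c, n+1, _, _, .impR _ _ Γ Δ A B a => .impR c n Γ Δ A B a.trunc
  | c, n+1, _, _, .box _ _ Γ Δ Θ l h a bs => .box c n Γ Δ Θ l h a.trunc (fun i => (bs i).trunc)
  | _, n+1, _, _, .cut _ Γ Δ A a b => .cut n Γ Δ A a.trunc b.trunc

def Frag.height : ∀ {c : Bool} {n : ℕ} {Γ Δ : Multiset Formula}, Frag c n Γ Δ → ℕ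
  | _, _, _, _, .hole _ _ _ => 0
  | _, _, _, _, .axP _ _ _ _ _ => 0
  | _, _, _, _, .axBot _ _ _ _ => 0
  | _, _, _, _, .impL _ _ _ _ _ _ a b => max a.height b.height + 1
  | _, _, _, _, .impR _ _ _ _ _ _ a => a.height + 1
  | _, _, _, _, .box _ _ _ _ _ _ _ a bs =>
      max a.height (Finset.univ.sup fun i => (bs i).height) + 1
  | _, _, _, _, .cut _ _ _ _ a b => max a.height b.height + 1

def Frag.cutFree : ∀ {c : Bool} {n : ℕ} {Γ Δ : Multiset Formula}, Frag c n Γ Δ → Prop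
  | _, _, _, _, .hole _ _ _ => True
  | _, _, _, _, .axP _ _ _ _ _ => True
  | _, _, _, _, .axBot _ _ _ _ => True
  | _, _, _, _, .impL _ _ _ _ _ _ a b => a.cutFree ∧ b.cutFree
  | _, _, _, _, .impR _ _ _ _ _ _ a => a.cutFree
  | _, _, _, _, .box _ _ _ _ _ _ _ a bs => a.cutFree ∧ ∀ i, (bs i).cutFree
  | _, _, _, _, .cut _ _ _ _ _ _ => False

structure InfProof (c : Bool) (Γ Δ : Multiset Formula) : Type where
  frag : ∀ n : ℕ, Frag c n Γ Δ
  compat : ∀ n : ℕ, (frag (n+1)).trunc = frag n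

structure PP : Type where
  Γ : Multiset Formula
  Δ : Multiset Formula
  prf : InfProof true Γ Δ

def Sim : ℕ → PP → PP → Prop
  | 0, _, _ => True
  | n+1, π, τ => π.Γ = τ.Γ ∧ π.Δ = τ.Δ ∧ HEq (π.prf.frag (n+1)) (τ.prf.frag (n+1))

noncomputable def dP (π τ : PP) : ℝ :=
  sInf {r : ℝ | ∃ n : ℕ, Sim n π τ ∧ r = (1/2 : ℝ) ^ n}

def localHeight (π : PP) : ℕ := (π.prf.frag 1).height

def Pmem (n : ℕ) (π : PP) : Prop := (π.prf.frag n).cutFree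

/-- `Covered Γ Δ true A` says that, in the sequent `Γ ⇒ Δ`, the formula `A` occurs in the antecedent
or has been decomposed there by implication rules; `Covered Γ Δ false A` is the same for the
succedent. -/
inductive Covered (Γ Δ : Multiset Formula) : Bool → Formula → Prop
  | left {A : Formula} : A ∈ Γ → Covered Γ Δ true A
  | right {A : Formula} : A ∈ Δ → Covered Γ Δ false A
  | impL_right {A B : Formula} : Covered Γ Δ true B → Covered Γ Δ true (A.imp B)
  | impL_left {A B : Formula} : Covered Γ Δ false A → Covered Γ Δ true (A.imp B)
  | impR {A B : Formula} :
      Covered Γ Δ true A → Covered Γ Δ false B → Covered Γ Δ false (A.imp B)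

theorem Covered.trans {Γ Δ Γ' Δ' : Multiset Formula} {s : Bool} {A : Formula}
    (h : Covered Γ Δ s A) (hL : ∀ X ∈ Γ, Covered Γ' Δ' true X)
    (hR : ∀ X ∈ Δ, Covered Γ' Δ' false X) : Covered Γ' Δ' s A := by
  induction h with
  | left h => exact hL _ h
  | right h => exact hR _ h
  | impL_right _ ih => exact .impL_right ih
  | impL_left _ ih => exact .impL_left ih
  | impR _ _ ih₁ ih₂ => exact .impR ih₁ ih₂

theorem Covered.of_impL_right {Γ Δ : Multiset Formula} {s : Bool} {A B X : Formula}
    (h : Covered ((A.imp B) ::ₘ Γ) Δ s X) : Covered (B ::ₘ Γ) Δ s X := by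
  refine h.trans (fun Y hY => ?_) fun Y hY => .right hY
  rcases Multiset.mem_cons.1 hY with rfl | hY
  · exact .impL_right (.left (Multiset.mem_cons_self _ _))
  · exact .left (Multiset.mem_cons_of_mem hY)

theorem Covered.of_impL_left {Γ Δ : Multiset Formula} {s : Bool} {A B X : Formula}
    (h : Covered ((A.imp B) ::ₘ Γ) Δ s X) : Covered Γ (A ::ₘ Δ) s X := by
  refine h.trans (fun Y hY => ?_) fun Y hY => .right (Multiset.mem_cons_of_mem hY)
  rcases Multiset.mem_cons.1 hY with rfl | hY
  · exact .impL_left (.right (Multiset.mem_cons_self _ _))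
  · exact .left hY

theorem Covered.of_impR {Γ Δ : Multiset Formula} {s : Bool} {A B X : Formula}
    (h : Covered Γ ((A.imp B) ::ₘ Δ) s X) : Covered (A ::ₘ Γ) (B ::ₘ Δ) s X := by
  refine h.trans (fun Y hY => .left (Multiset.mem_cons_of_mem hY)) fun Y hY => ?_
  rcases Multiset.mem_cons.1 hY with rfl | hY
  · exact .impR (.left (Multiset.mem_cons_self _ _)) (.right (Multiset.mem_cons_self _ _))
  · exact .right (Multiset.mem_cons_of_mem hY)

theorem mem_boxtimes {Γ : Multiset Formula} {X : Formula} :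
    X ∈ boxtimes Γ ↔ X ∈ Γ ∨ ∃ Y ∈ Γ, Y.box = X := by
  simp [boxtimes]

theorem exists_eq_add_map_box (Γ : Multiset Formula) :
    ∃ Γ₀ Θ : Multiset Formula, Γ = Γ₀ + Θ.map Formula.box ∧ ∀ A, A.box ∈ Γ → A ∈ Θ := by
  induction Γ using Multiset.induction_on with
  | empty => exact ⟨0, 0, by simp, by simp⟩
  | cons B Γ ih =>
    obtain ⟨Γ₀, Θ, rfl, h⟩ := ih
    by_cases hB : ∃ C : Formula, B = C.box
    · obtain ⟨C, rfl⟩ := hB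
      refine ⟨Γ₀, C ::ₘ Θ, by simp, fun A hA => ?_⟩
      rcases Multiset.mem_cons.1 hA with hA | hA
      · exact Multiset.mem_cons.2 (.inl (Formula.box.inj hA))
      · exact Multiset.mem_cons_of_mem (h A hA)
    · refine ⟨B ::ₘ Γ₀, Θ, by simp, fun A hA => ?_⟩
      rcases Multiset.mem_cons.1 hA with hA | hA
      · exact absurd ⟨A, hA.symm⟩ hB
      · exact h A hA

namespace GoSeq

theorem of_mem {c : Bool} {Γ Δ : Multiset Formula} {A : Formula} (hΓ : A ∈ Γ) (hΔ : A ∈ Δ) :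
    GoSeq c Γ Δ := by
  obtain ⟨Γ, rfl⟩ := Multiset.exists_cons_of_mem hΓ
  obtain ⟨Δ, rfl⟩ := Multiset.exists_cons_of_mem hΔ
  exact .ax c Γ Δ A

theorem of_covered_both {c : Bool} (A : Formula) {Γ Δ : Multiset Formula}
    (hL : Covered Γ Δ true A) (hR : Covered Γ Δ false A) : GoSeq c Γ Δ := by
  induction A generalizing Γ Δ with
  | atom p =>
    cases hL with | left hL => cases hR with | right hR => exact of_mem hL hR
  | bot =>
    cases hL with | left hL => cases hR with | right hR => exact of_mem hL hR
  | box A _ =>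
    cases hL with | left hL => cases hR with | right hR => exact of_mem hL hR
  | imp A B ihA ihB =>
    cases hR with
    | right hR =>
      obtain ⟨Δ, rfl⟩ := Multiset.exists_cons_of_mem hR
      cases hL with
      | left hL => exact of_mem hL hR
      | impL_right hL =>
        exact .impR _ _ _ _ _ (ihB hL.of_impR (.right (Multiset.mem_cons_self _ _)))
      | impL_left hL =>
        exact .impR _ _ _ _ _ (ihA (.left (Multiset.mem_cons_self _ _)) hL.of_impR)
    | impR hA hB =>
      cases hL with
      | left hL =>
        obtain ⟨Γ, rfl⟩ := Multiset.exists_cons_of_mem hL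
        exact .impL _ _ _ _ _ (ihB (.left (Multiset.mem_cons_self _ _)) hB.of_impL_right)
          (ihA hA.of_impL_left (.right (Multiset.mem_cons_self _ _)))
      | impL_right hL => exact ihB hL hB
      | impL_left hL => exact ihA hA hL

/-- Weakening, contraction and inversion of the implication rules, all at once. -/
theorem of_covered {c : Bool} {Γ Δ : Multiset Formula} (h : GoSeq c Γ Δ)
    {Γ' Δ' : Multiset Formula} (hL : ∀ X ∈ Γ, Covered Γ' Δ' true X)
    (hR : ∀ X ∈ Δ, Covered Γ' Δ' false X) : GoSeq c Γ' Δ' := by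
  induction h generalizing Γ' Δ' with
  | ax c Γ Δ A =>
    exact of_covered_both A (hL _ (Multiset.mem_cons_self _ _))
      (hR _ (Multiset.mem_cons_self _ _))
  | axBot c Γ Δ =>
    cases hL _ (Multiset.mem_cons_self _ _) with
    | left h =>
      obtain ⟨Γ', rfl⟩ := Multiset.exists_cons_of_mem h
      exact .axBot _ _ _
  | impL c Γ Δ A B _ _ ih₁ ih₂ =>
    rw [Multiset.forall_mem_cons] at hL
    obtain ⟨hAB, hL⟩ := hL
    cases hAB with
    | left h =>
      obtain ⟨Γ', rfl⟩ := Multiset.exists_cons_of_mem h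
      refine .impL _ _ _ _ _ (ih₁ ?_ fun X hX => (hR X hX).of_impL_right) (ih₂ ?_ ?_)
      · exact Multiset.forall_mem_cons.2
          ⟨.left (Multiset.mem_cons_self _ _), fun X hX => (hL X hX).of_impL_right⟩
      · exact fun X hX => (hL X hX).of_impL_left
      · exact Multiset.forall_mem_cons.2
          ⟨.right (Multiset.mem_cons_self _ _), fun X hX => (hR X hX).of_impL_left⟩
    | impL_right h => exact ih₁ (Multiset.forall_mem_cons.2 ⟨h, hL⟩) hR
    | impL_left h => exact ih₂ hL (Multiset.forall_mem_cons.2 ⟨h, hR⟩)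
  | impR c Γ Δ A B _ ih =>
    rw [Multiset.forall_mem_cons] at hR
    obtain ⟨hAB, hR⟩ := hR
    cases hAB with
    | right h =>
      obtain ⟨Δ', rfl⟩ := Multiset.exists_cons_of_mem h
      refine .impR _ _ _ _ _ (ih ?_ ?_)
      · exact Multiset.forall_mem_cons.2
          ⟨.left (Multiset.mem_cons_self _ _), fun X hX => (hL X hX).of_impR⟩
      · exact Multiset.forall_mem_cons.2
          ⟨.right (Multiset.mem_cons_self _ _), fun X hX => (hR X hX).of_impR⟩
    | impR hA hB =>
      exact ih (Multiset.forall_mem_cons.2 ⟨hA, hL⟩) (Multiset.forall_mem_cons.2 ⟨hB, hR⟩)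
  | boxGo c Γ Δ Θ A _ ih =>
    cases hR _ (Multiset.mem_cons_self _ _) with
    | right h =>
      obtain ⟨Δ', rfl⟩ := Multiset.exists_cons_of_mem h
      obtain ⟨Γ₀, Θ', rfl, hΘ'⟩ := exists_eq_add_map_box Γ'
      have hΘ : Θ ⊆ Θ' := fun X hX => by
        cases hL X.box (Multiset.mem_add.2 (.inr (Multiset.mem_map_of_mem _ hX))) with
        | left h => exact hΘ' X h
      refine .boxGo _ _ _ _ _ (ih (fun X hX => .left ?_) fun X hX => .right hX)
      simp only [Multiset.mem_cons, mem_boxtimes] at hX ⊢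
      rcases hX with rfl | hX | ⟨Y, hY, rfl⟩
      · exact .inl rfl
      · exact .inr (.inl (hΘ hX))
      · exact .inr (.inr ⟨Y, hΘ hY, rfl⟩)
  | cut Γ Δ A _ _ ih₁ ih₂ =>
    have hL' : ∀ X ∈ Γ, Covered (A ::ₘ Γ') Δ' true X := fun X hX =>
      (hL X hX).trans (fun Y hY => .left (Multiset.mem_cons_of_mem hY)) fun Y hY => .right hY
    have hR' : ∀ X ∈ Δ, Covered (A ::ₘ Γ') Δ' false X := fun X hX =>
      (hR X hX).trans (fun Y hY => .left (Multiset.mem_cons_of_mem hY)) fun Y hY => .right hY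
    have hL'' : ∀ X ∈ Γ, Covered Γ' (A ::ₘ Δ') true X := fun X hX =>
      (hL X hX).trans (fun Y hY => .left hY) fun Y hY => .right (Multiset.mem_cons_of_mem hY)
    have hR'' : ∀ X ∈ Δ, Covered Γ' (A ::ₘ Δ') false X := fun X hX =>
      (hR X hX).trans (fun Y hY => .left hY) fun Y hY => .right (Multiset.mem_cons_of_mem hY)
    exact .cut _ _ A
      (ih₁ hL'' (Multiset.forall_mem_cons.2 ⟨.right (Multiset.mem_cons_self _ _), hR''⟩))
      (ih₂ (Multiset.forall_mem_cons.2 ⟨.left (Multiset.mem_cons_self _ _), hL'⟩) hR')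

theorem mono {c : Bool} {Γ Δ Γ' Δ' : Multiset Formula} (h : GoSeq c Γ Δ) (hΓ : Γ ⊆ Γ')
    (hΔ : Δ ⊆ Δ') : GoSeq c Γ' Δ' :=
  h.of_covered (fun _ hX => .left (hΓ hX)) fun _ hX => .right (hΔ hX)

theorem impL_of_mem {c : Bool} {Γ Δ : Multiset Formula} {A B : Formula} (hAB : A.imp B ∈ Γ)
    (h₁ : GoSeq c (B ::ₘ Γ) Δ) (h₂ : GoSeq c Γ (A ::ₘ Δ)) : GoSeq c Γ Δ :=
  (impL c Γ Δ A B h₁ h₂).mono (Multiset.cons_subset.2 ⟨hAB, Multiset.Subset.refl _⟩)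
    (Multiset.Subset.refl _)

theorem boxGo_of_mem {c : Bool} {Γ Δ Θ : Multiset Formula} {A : Formula}
    (hΘ : Θ.map Formula.box ⊆ Γ) (hA : A.box ∈ Δ)
    (h : GoSeq c ((A.imp A.box).box ::ₘ boxtimes Θ) {A}) : GoSeq c Γ Δ :=
  (boxGo c 0 0 Θ A h).mono (by simpa using hΘ) (by simpa using hA)

theorem remove_unboxed {c : Bool} {Γ Δ : Multiset Formula} (l : List Formula)
    (hΓ : ∀ A ∈ l, A.imp A.box ∈ Γ) (hΔ : ∀ A ∈ l, A.box ∈ Δ)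
    (h : GoSeq c Γ ((l : Multiset Formula) + Δ)) : GoSeq c Γ Δ := by
  induction l with
  | nil => simpa using h
  | cons A l ih =>
    refine ih (fun B hB => hΓ B (List.mem_cons_of_mem _ hB))
      (fun B hB => hΔ B (List.mem_cons_of_mem _ hB)) ?_
    refine impL_of_mem (hΓ A List.mem_cons_self)
      (of_mem (Multiset.mem_cons_self _ _)
        (Multiset.mem_add.2 (.inr (hΔ A List.mem_cons_self)))) ?_
    rwa [← Multiset.cons_coe, Multiset.cons_add] at h

end GoSeq

structure SubformulaClosed (U : Finset Formula) : Prop where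
  imp_left {A B : Formula} : A.imp B ∈ U → A ∈ U
  imp_right {A B : Formula} : A.imp B ∈ U → B ∈ U
  box {A : Formula} : A.box ∈ U → A ∈ U

def Formula.subformulas : Formula → Finset Formula
  | .atom p => {.atom p}
  | .bot => {.bot}
  | .imp A B => insert (.imp A B) (A.subformulas ∪ B.subformulas)
  | .box A => insert (.box A) A.subformulas

theorem Formula.mem_subformulas_self (A : Formula) : A ∈ A.subformulas := by
  cases A <;> simp [Formula.subformulas]

theorem Formula.subformulaClosed_subformulas (A : Formula) : SubformulaClosed A.subformulas := by
  induction A with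
  | atom p => constructor <;> simp [Formula.subformulas]
  | bot => constructor <;> simp [Formula.subformulas]
  | imp A B ihA ihB =>
    have hA := A.mem_subformulas_self
    have hB := B.mem_subformulas_self
    constructor <;> intros <;>
      grind [Formula.subformulas, ihA.imp_left, ihA.imp_right, ihA.box,
        ihB.imp_left, ihB.imp_right, ihB.box]
  | box A ih =>
    have hA := A.mem_subformulas_self
    constructor <;> intros <;>
      grind [Formula.subformulas, ih.imp_left, ih.imp_right, ih.box]

theorem exists_subformulaClosed (Γ : Multiset Formula) :
    ∃ U : Finset Formula, SubformulaClosed U ∧ ∀ X ∈ Γ, X ∈ U := by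
  refine ⟨Γ.toFinset.biUnion Formula.subformulas, ⟨?_, ?_, ?_⟩, fun X hX =>
    Finset.mem_biUnion.2 ⟨X, Multiset.mem_toFinset.2 hX, X.mem_subformulas_self⟩⟩
  all_goals
    intros
    rename_i h
    obtain ⟨X, hX, h⟩ := Finset.mem_biUnion.1 h
    refine Finset.mem_biUnion.2 ⟨X, hX, ?_⟩
  · exact X.subformulaClosed_subformulas.imp_left h
  · exact X.subformulaClosed_subformulas.imp_right h
  · exact X.subformulaClosed_subformulas.box h

/-- A sufficiently deep cut-free fragment yields a finite derivation. The finite sets `S` and `L`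
record the formulas available in the antecedent in the forms `A, □A` and `□A` respectively. -/
theorem Frag.goSeq {U V : Finset Formula} (hU : SubformulaClosed U) (hUV : U ⊆ V)
    (hV : ∀ A ∈ U, A.imp A.box ∈ V) {c : Bool} {n : ℕ} {Γ Δ : Multiset Formula}
    (f : Frag c n Γ Δ) (hc : c = false) (hΓ : ∀ X ∈ Γ, X ∈ U) (hΔ : ∀ X ∈ Δ, X ∈ U)
    (S L : Finset Formula) (hL : L ⊆ V) (hn : (V \ S).card + (V \ (S ∪ L)).card < n) :
    GoSeq c (Γ + (boxtimes S.val + L.val.map Formula.box)) Δ := by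
  induction f generalizing S L with
  | hole => exact absurd hn (Nat.not_lt_zero _)
  | axP c n Γ Δ p =>
    rw [Multiset.cons_add]
    exact .ax _ _ _ _
  | axBot c n Γ Δ =>
    rw [Multiset.cons_add]
    exact .axBot _ _ _
  | impL c n Γ Δ A B a b iha ihb =>
    rw [Multiset.forall_mem_cons] at hΓ
    rw [Multiset.cons_add]
    refine .impL _ _ _ _ _ ?_ ?_
    · rw [← Multiset.cons_add]
      exact iha hc (Multiset.forall_mem_cons.2 ⟨hU.imp_right hΓ.1, hΓ.2⟩) hΔ S L hL hn
    · exact ihb hc hΓ.2 (Multiset.forall_mem_cons.2 ⟨hU.imp_left hΓ.1, hΔ⟩) S L hL hn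
  | impR c n Γ Δ A B a ih =>
    rw [Multiset.forall_mem_cons] at hΔ
    refine .impR _ _ _ _ _ ?_
    rw [← Multiset.cons_add]
    exact ih hc (Multiset.forall_mem_cons.2 ⟨hU.imp_left hΔ.1, hΓ⟩)
      (Multiset.forall_mem_cons.2 ⟨hU.imp_right hΔ.1, hΔ.2⟩) S L hL hn
  | box c n Γ Δ Θ l hl a bs iha ihbs =>
    have hΘbox : ∀ X ∈ Θ, X.box ∈ U := fun X hX =>
      hΓ _ (Multiset.mem_add.2 (.inr (Multiset.mem_map_of_mem _ hX)))
    have hΘ : ∀ X ∈ Θ, X ∈ U := fun X hX => hU.box (hΘbox X hX)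
    have hlbox : ∀ X ∈ l, X.box ∈ U := fun X hX =>
      hΔ _ (Multiset.mem_add.2 (.inl (List.mem_map_of_mem hX)))
    have hl' : ∀ X ∈ l, X ∈ U := fun X hX => hU.box (hlbox X hX)
    have hΘU : ∀ X ∈ boxtimes Θ, X ∈ U := by
      intro X hX
      rcases mem_boxtimes.1 hX with hX | ⟨Y, hY, rfl⟩
      exacts [hΘ X hX, hΘbox Y hY]
    -- Passing to the right premise of `A` by the rule of `Go_Seq`.
    have step : ∀ A ∈ l, (V \ (S ∪ (Θ.toFinset ∪ L))).card +
        (V \ (S ∪ (Θ.toFinset ∪ L) ∪ {A.imp A.box})).card < n →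
        GoSeq c (Γ + Θ.map Formula.box + (boxtimes S.val + L.val.map Formula.box))
          (↑(l.map Formula.box) + Δ) := by
      intro A hA hlt
      obtain ⟨i, rfl⟩ := List.get_of_mem hA
      have h := ihbs i hc hΘU (by simpa using hl' _ hA) (S ∪ (Θ.toFinset ∪ L))
        {(l.get i).imp (l.get i).box} (by simpa using hV _ (hl' _ hA)) hlt
      refine GoSeq.boxGo_of_mem (Θ := S.val + (Θ + L.val)) (A := l.get i) ?_ ?_
        (h.mono ?_ (Multiset.Subset.refl _))
      · intro X hX
        simp only [Multiset.map_add, Multiset.mem_add, Multiset.mem_map, mem_boxtimes] at hX ⊢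
        rcases hX with h | h | h
        exacts [.inr (.inl (.inr h)), .inl (.inr h), .inr (.inr h)]
      · exact Multiset.mem_add.2 (.inl (List.mem_map_of_mem hA))
      · intro X hX
        simp only [Multiset.mem_add, Multiset.mem_map, Multiset.mem_cons, mem_boxtimes,
          Finset.mem_val, Finset.mem_union, Multiset.mem_toFinset, Finset.mem_singleton] at hX ⊢
        rcases hX with (h | ⟨Y, hY, rfl⟩) | h | ⟨_, rfl, rfl⟩
        exacts [.inr (.inl (.inr (.inl h))), .inr (.inr ⟨Y, .inr (.inl hY), rfl⟩), .inr h, .inl rfl]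
    by_cases hsub : Θ.toFinset ∪ L ⊆ S
    · rw [Finset.union_eq_left.2 hsub] at step
      by_cases hall : ∀ A ∈ l, A.imp A.box ∈ S
      · have h := iha hc hΘU (fun X hX => by
          rcases mem_boxtimes.1 hX with hX | ⟨Y, hY, rfl⟩
          exacts [hl' X hX, hlbox Y hY]) S L hL hn
        refine GoSeq.remove_unboxed l (fun A hA => ?_) (fun A hA => ?_) (h.mono ?_ ?_)
        · simp only [Multiset.mem_add, mem_boxtimes]
          exact .inr (.inl (.inl (hall A hA)))
        · exact Multiset.mem_add.2 (.inl (List.mem_map_of_mem hA))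
        · intro X hX
          have hΘS : ∀ Y ∈ Θ, Y ∈ S := fun Y hY =>
            hsub (Finset.mem_union_left _ (Multiset.mem_toFinset.2 hY))
          simp only [Multiset.mem_add, Multiset.mem_map, mem_boxtimes, Finset.mem_val] at hX ⊢
          grind
        · intro X hX
          simp only [Multiset.mem_add, mem_boxtimes, Multiset.mem_coe, List.mem_map] at hX ⊢
          exact hX.imp_right .inl
      · push Not at hall
        obtain ⟨A, hA, hAS⟩ := hall
        refine step A hA ?_
        have hLS : S ∪ L = S := Finset.union_eq_left.2 (Finset.union_subset_right hsub)
        have hlt : (V \ (S ∪ {A.imp A.box})).card < (V \ S).card := by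
          refine Finset.card_lt_card (Finset.ssubset_iff_of_subset
            (Finset.sdiff_subset_sdiff subset_rfl Finset.subset_union_left) |>.2
            ⟨A.imp A.box, ?_, ?_⟩)
          · exact Finset.mem_sdiff.2 ⟨hV A (hl' A hA), hAS⟩
          · simp
        rw [hLS] at hn
        omega
    · obtain ⟨A, hA⟩ := List.exists_mem_of_ne_nil l hl
      refine step A hA ?_
      obtain ⟨X, hX, hXS⟩ := Finset.not_subset.1 hsub
      have hXV : X ∈ V := by
        rcases Finset.mem_union.1 hX with h | h
        exacts [hUV (hΘ X (Multiset.mem_toFinset.1 h)), hL h]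
      have hlt : (V \ (S ∪ (Θ.toFinset ∪ L))).card < (V \ S).card := by
        refine Finset.card_lt_card (Finset.ssubset_iff_of_subset
          (Finset.sdiff_subset_sdiff subset_rfl Finset.subset_union_left) |>.2 ⟨X, ?_, ?_⟩)
        · exact Finset.mem_sdiff.2 ⟨hXV, hXS⟩
        · exact fun h => (Finset.mem_sdiff.1 h).2 (Finset.mem_union_right _ hX)
      have hle : (V \ (S ∪ (Θ.toFinset ∪ L) ∪ {A.imp A.box})).card ≤ (V \ (S ∪ L)).card := by
        refine Finset.card_le_card (Finset.sdiff_subset_sdiff subset_rfl ?_)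
        intro Y hY
        simp only [Finset.mem_union] at hY ⊢
        tauto
      omega
  | cut => cases hc

theorem stmt8 (Γ Δ : Multiset Formula) :
    Nonempty (InfProof false Γ Δ) → GoSeq false Γ Δ := by
  rintro ⟨π⟩
  obtain ⟨U, hU, hmem⟩ := exists_subformulaClosed (Γ + Δ)
  have h := (π.frag _).goSeq hU
    (V := U ∪ U.image fun A => A.imp A.box) Finset.subset_union_left
    (fun A hA => Finset.mem_union_right _ (Finset.mem_image_of_mem _ hA)) rfl
    (fun X hX => hmem X (Multiset.mem_add.2 (.inl hX)))
    (fun X hX => hmem X (Multiset.mem_add.2 (.inr hX))) ∅ ∅ (Finset.empty_subset _)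
    (Nat.lt_succ_self _)
  simpa [boxtimes] using h
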